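/- For all integers n, r ≥ 2, the list chromatic number of the complete multipartite graph K_{n*r} satisfies χ_ℓ(K_{n*r}) > (n−1)·⌊(2r−1)/n⌋. -/

import Mathlib

/-- Vertex type of the Latin-square construction graph: `Sum.inl (a, c)` encodes the
vertex `v_{a+1, c+1}` of `P`, and `Sum.inr (i, j)` encodes the vertex `w_{i+1, j+1}` of `Q`
(all indices written 0-indexed via `Fin`/`ZMod`). -/
def LSVertex (n : ℕ) : Type := (Fin n × ZMod n) ⊕ (Fin (n - 1) × ZMod n)

/-- The Latin-square construction graph: the cliques `T_j` consist of the `P`-vertices with a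
fixed second coordinate, and `w_{i,j}` is joined to `v_{k, L_i(j,k)}` for every `k`, where
`L_i(j,k) ≡ j + i(k-1) (mod n)` (all written 0-indexed, so the second coordinate of a
neighbor `v_{k, L_i(j,k)}` of `w_{i,j}` is `(j-1) + i·(k-1)` in `ZMod n`). -/
def latinGraph (n : ℕ) : SimpleGraph (LSVertex n) where
  Adj x y :=
    match x, y with
    | Sum.inl (a, c), Sum.inl (b, c') => c = c' ∧ a ≠ b
    | Sum.inl (k, c), Sum.inr (i, j) => c = j + (((i : ℕ) : ZMod n) + 1) * ((k : ℕ) : ZMod n)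
    | Sum.inr (i, j), Sum.inl (k, c) => c = j + (((i : ℕ) : ZMod n) + 1) * ((k : ℕ) : ZMod n)
    | Sum.inr _, Sum.inr _ => False
  symm := by
    constructor
    rintro (⟨a, c⟩ | ⟨i, j⟩) (⟨b, c'⟩ | ⟨i', j'⟩) h
    · exact ⟨h.1.symm, h.2.symm⟩
    · exact h
    · exact h
    · exact h
  loopless := by
    constructor
    rintro (⟨a, c⟩ | ⟨i, j⟩) h
    · exact h.2 rfl
    · exact h

/-- The set `P` of all `v`-vertices. -/
def Pall (n : ℕ) : Set (LSVertex n) := {x | ∃ a c, x = Sum.inl (a, c)}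

/-- The set `Q` of all `w`-vertices. -/
def Qall (n : ℕ) : Set (LSVertex n) := {x | ∃ i j, x = Sum.inr (i, j)}

/-- The partite set `P_{a+1} = {v_{a+1,1}, …, v_{a+1,n}}`. -/
def Pset (n : ℕ) (a : Fin n) : Set (LSVertex n) := {x | ∃ c, x = Sum.inl (a, c)}

/-- The clique `T_{c+1} = {v_{1,c+1}, …, v_{n,c+1}}`. -/
def Tset (n : ℕ) (c : ZMod n) : Set (LSVertex n) := {x | ∃ a, x = Sum.inl (a, c)}

/-- The partite set `Q_{i+1} = {w_{i+1,1}, …, w_{i+1,n}}`. -/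
def Qset (n : ℕ) (i : Fin (n - 1)) : Set (LSVertex n) := {x | ∃ j, x = Sum.inr (i, j)}

/-- The square of a graph: two distinct vertices are adjacent iff their distance in `G`
is at most 2, i.e. they are adjacent in `G` or have a common neighbor. -/
def graphSquare {V : Type*} (G : SimpleGraph V) : SimpleGraph V where
  Adj x y := x ≠ y ∧ (G.Adj x y ∨ ∃ z, G.Adj x z ∧ G.Adj z y)
  symm := by
    constructor
    rintro x y ⟨hxy, h | ⟨z, h1, h2⟩⟩
    · exact ⟨hxy.symm, Or.inl h.symm⟩
    · exact ⟨hxy.symm, Or.inr ⟨z, h2.symm, h1.symm⟩⟩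
  loopless := ⟨fun x h => h.1 rfl⟩

/-- `G` is `k`-choosable: for any assignment of a list of at least `k` colors to each
vertex, there is a proper coloring choosing each vertex's color from its list. -/
def Choosable {V : Type*} (G : SimpleGraph V) (k : ℕ) : Prop :=
  ∀ L : V → Finset ℕ, (∀ v, k ≤ (L v).card) →
    ∃ φ : V → ℕ, (∀ v, φ v ∈ L v) ∧ ∀ ⦃u w⦄, G.Adj u w → φ u ≠ φ w

/-- The list chromatic number: the least `k` such that `G` is `k`-choosable. -/
noncomputable def listChromaticNumber {V : Type*} (G : SimpleGraph V) : ℕ :=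
  sInf {k | Choosable G k}

/-- The chromatic number: the least `k` such that `G` has a proper `k`-coloring. -/
noncomputable def chromNum {V : Type*} (G : SimpleGraph V) : ℕ :=
  sInf {k | G.Colorable k}

theorem choosable_card_aux {V : Type*} [Fintype V] (G : SimpleGraph V) :
    Choosable G (Fintype.card V) := by
  classical
  intro L hL
  have h := (Finset.all_card_le_biUnion_card_iff_exists_injective L).1 (by
    intro s
    rcases s.eq_empty_or_nonempty with rfl | ⟨v, hv⟩
    · simp
    · exact (Finset.card_le_univ s).trans ((hL v).trans
        (Finset.card_le_card (Finset.subset_biUnion_of_mem L hv))))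
  obtain ⟨f, hf, hm⟩ := h
  exact ⟨f, hm, fun u w huw he => huw.ne (hf he)⟩

theorem not_choosable_aux (n r m : ℕ) (hn : 2 ≤ n) (hm : n * m < 2 * r) :
    ¬ Choosable (SimpleGraph.completeMultipartiteGraph (fun _ : Fin r => Fin n))
      ((n - 1) * m) := by
  classical
  intro H
  let e : Fin n × Fin m ↪ ℕ := finProdFinEquiv.toEmbedding.trans Fin.valEmbedding
  obtain ⟨φ, h1, h2⟩ := H (fun v => ((Finset.univ.erase v.2) ×ˢ Finset.univ).map e) (by
    intro v
    simp [Finset.card_product, Finset.card_erase_of_mem])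
  have h3 : ∀ v : (Σ _ : Fin r, Fin n), ∃ p : Fin n × Fin m, p.1 ≠ v.2 ∧ e p = φ v := by
    intro v
    have := h1 v
    rw [Finset.mem_map] at this
    obtain ⟨p, hp, hpe⟩ := this
    rw [Finset.mem_product, Finset.mem_erase] at hp
    exact ⟨p, hp.1.1, hpe⟩
  choose ψ hψ hφ using h3
  have key : ∀ u w : (Σ _ : Fin r, Fin n), ψ u = ψ w → u.1 = w.1 := by
    intro u w huw
    by_contra hne
    exact h2 (u := u) (w := w) hne (by rw [← hφ, ← hφ, huw])
  let z : Fin n := ⟨0, by omega⟩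
  let g : Fin r × Bool → (Σ _ : Fin r, Fin n) := fun x =>
    if x.2 then ⟨x.1, (ψ ⟨x.1, z⟩).1⟩ else ⟨x.1, z⟩
  have hg : ∀ x, (g x).1 = x.1 := by
    rintro ⟨i, b⟩
    cases b <;> simp [g]
  have hinj : Function.Injective (fun x => ψ (g x)) := by
    rintro ⟨i, b⟩ ⟨i', b'⟩ h
    have hi : i = i' := by
      have := key _ _ h
      rwa [hg, hg] at this
    subst hi
    have hd : ψ (g (i, true)) ≠ ψ (g (i, false)) := by
      intro h
      have := hψ (g (i, true))
      rw [h] at this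
      simp [g] at this
    cases b <;> cases b'
    · rfl
    · exact absurd h.symm hd
    · exact absurd h hd
    · rfl
  have := Fintype.card_le_of_injective _ hinj
  simp at this
  omega

/-- For all integers `n, r ≥ 2`, the complete multipartite graph `K_{n*r}` satisfies
`χ_ℓ(K_{n*r}) > (n-1)·⌊(2r-1)/n⌋`. -/
theorem listChromatic_completeMultipartite_lt (n r : ℕ) (hn : 2 ≤ n) (hr : 2 ≤ r) :
    (n - 1) * ((2 * r - 1) / n) <
      listChromaticNumber (SimpleGraph.completeMultipartiteGraph (fun _ : Fin r => Fin n)) := by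
  by_contra hlt
  have hmem : Choosable (SimpleGraph.completeMultipartiteGraph (fun _ : Fin r => Fin n))
      (listChromaticNumber
        (SimpleGraph.completeMultipartiteGraph (fun _ : Fin r => Fin n))) :=
    Nat.sInf_mem (s := {k | Choosable _ k}) ⟨_, choosable_card_aux _⟩
  have hm : n * ((2 * r - 1) / n) < 2 * r := by
    have := Nat.mul_div_le (2 * r - 1) n
    omega
  exact not_choosable_aux n r _ hn hm
    (fun L hL => hmem L (fun v => (not_lt.1 hlt).trans (hL v)))
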